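/- Let n ≥ 2 and w ∈ G(∞,∞,n); for each row index i let c_i be the unique column with w[i,c_i] ≠ 0 and set a_i = w[i,c_i]. Then: (a) if c_1 < c_2 then for every k ∈ ℤ, ℓ(t_k w) = ℓ(w) − 1 if and only if a_2 ≠ 1; (b) if c_1 > c_2 then for every k ∈ ℤ, ℓ(t_k w) = ℓ(w) − 1 if and only if a_1 = x^{−k}. -/

import Mathlib

/-- The indeterminate `x` in the field `K = ℚ(x)` of rational functions over `ℚ`. -/
noncomputable def xx : RatFunc ℚ := RatFunc.X

/-- Membership in `G(∞,∞,n)`: a monomial matrix whose nonzero entries are integer powers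
of `x` and such that the product of the nonzero entries is `1`. -/
def IsGinf (n : ℕ) (w : Matrix (Fin n) (Fin n) (RatFunc ℚ)) : Prop :=
  (∀ i : Fin n, ∃! c : Fin n, w i c ≠ 0) ∧
  (∀ c : Fin n, ∃! i : Fin n, w i c ≠ 0) ∧
  (∀ i c : Fin n, w i c ≠ 0 → ∃ k : ℤ, w i c = xx ^ k) ∧
  (∏ i : Fin n, ∑ c : Fin n, w i c) = 1

/-- The generator `t_i` (1-indexed rows/columns 1,2 are `Fin` indices 0,1). -/
noncomputable def tMat (n : ℕ) (i : ℤ) : Matrix (Fin n) (Fin n) (RatFunc ℚ) :=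
  fun r c =>
    if r.val = 0 ∧ c.val = 1 then xx ^ (-i)
    else if r.val = 1 ∧ c.val = 0 then xx ^ i
    else if r = c ∧ 2 ≤ r.val then 1 else 0

/-- The generator `s_j` (`3 ≤ j ≤ n`): permutation matrix of the transposition exchanging
coordinates `j-1` and `j` (1-indexed), i.e. `Fin` indices `j-2` and `j-1`. -/
noncomputable def sMat (n : ℕ) (j : ℕ) : Matrix (Fin n) (Fin n) (RatFunc ℚ) :=
  fun r c =>
    if (r.val + 2 = j ∧ c.val + 1 = j) ∨ (r.val + 1 = j ∧ c.val + 2 = j) ∨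
       (r = c ∧ r.val + 2 ≠ j ∧ r.val + 1 ≠ j) then 1 else 0

/-- The generating set `X = {t_i : i ∈ ℤ} ∪ {s_j : 3 ≤ j ≤ n}`. -/
def Xset (n : ℕ) : Set (Matrix (Fin n) (Fin n) (RatFunc ℚ)) :=
  {w | (∃ i : ℤ, w = tMat n i) ∨ (∃ j : ℕ, 3 ≤ j ∧ j ≤ n ∧ w = sMat n j)}

/-- `len n w` is the minimal `m` such that `w` is a product of `m` elements of `X`. -/
noncomputable def len (n : ℕ) (w : Matrix (Fin n) (Fin n) (RatFunc ℚ)) : ℕ :=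
  sInf {m | ∃ L : List (Matrix (Fin n) (Fin n) (RatFunc ℚ)),
    L.length = m ∧ (∀ a ∈ L, a ∈ Xset n) ∧ L.prod = w}

/-- Left divisibility: `v ⪯ w` iff `ℓ(v) + ℓ(v⁻¹ w) = ℓ(w)`. -/
def preL (n : ℕ) (v w : Matrix (Fin n) (Fin n) (RatFunc ℚ)) : Prop :=
  len n v + len n (v⁻¹ * w) = len n w

/-- Right divisibility: `v ⪯_r w` iff `ℓ(w v⁻¹) + ℓ(v) = ℓ(w)`. -/
def preR (n : ℕ) (v w : Matrix (Fin n) (Fin n) (RatFunc ℚ)) : Prop :=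
  len n (w * v⁻¹) + len n v = len n w

/-- The element `λ = diag(x^{-(n-1)}, x, …, x)`. -/
noncomputable def lam (n : ℕ) : Matrix (Fin n) (Fin n) (RatFunc ℚ) :=
  Matrix.diagonal (fun i => if i.val = 0 then xx ^ (-((n : ℤ) - 1)) else xx)

open Finset Equiv

/-- The monomial matrix whose row `r` has the single entry `a r`, in column `c r`. -/
noncomputable def monoMat {n : ℕ} (c : Fin n → Fin n) (a : Fin n → RatFunc ℚ) :
    Matrix (Fin n) (Fin n) (RatFunc ℚ) :=
  fun r s => if s = c r then a r else 0

/-- The data `(c, a)` describe an element of `G(∞,∞,n)`. -/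
def IsGinfData {n : ℕ} (c : Fin n → Fin n) (a : Fin n → RatFunc ℚ) : Prop :=
  Function.Injective c ∧ (∀ r, ∃ k : ℤ, a r = xx ^ k) ∧ ∏ r, a r = 1

/-- The coefficients of the generator exchanging rows `i` and `j`, with parameter `k`. -/
noncomputable def genCoeff {n : ℕ} (i j : Fin n) (k : ℤ) (r : Fin n) : RatFunc ℚ :=
  (if r = i then xx ^ (-k) else 1) * (if r = j then xx ^ k else 1)

open Classical in
/-- The contribution of a pair of rows `l < r` to the length. -/
noncomputable def pairWeight {n : ℕ} (c : Fin n → Fin n) (a : Fin n → RatFunc ℚ)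
    (l r : Fin n) : ℕ :=
  if c r < c l then 1 else if a r = 1 then 0 else 2

/-- The number of inversions of `c` plus twice the number of non-inversions `l < r`
with `a r ≠ 1`. -/
noncomputable def weight {n : ℕ} (c : Fin n → Fin n) (a : Fin n → RatFunc ℚ) : ℕ :=
  ∑ p : Fin n × Fin n with p.1 < p.2, pairWeight c a p.1 p.2

lemma xx_ne_zero : xx ≠ 0 := RatFunc.X_ne_zero

section

variable {n : ℕ}

lemma IsGinfData.ne_zero {c : Fin n → Fin n} {a : Fin n → RatFunc ℚ} (h : IsGinfData c a)
    (r : Fin n) : a r ≠ 0 := by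
  obtain ⟨k, hk⟩ := h.2.1 r
  rw [hk]
  exact zpow_ne_zero _ xx_ne_zero

lemma monoMat_id_one : monoMat (n := n) id 1 = 1 := by
  ext r s
  simp [monoMat, Matrix.one_apply, eq_comm]

lemma monoMat_mul (c d : Fin n → Fin n) (a b : Fin n → RatFunc ℚ) :
    monoMat d b * monoMat c a = monoMat (c ∘ d) (fun r => b r * a (d r)) := by
  ext r s
  simp only [monoMat, Matrix.mul_apply]
  rw [sum_eq_single (d r) (fun t _ ht => by simp [ht]) (by simp)]
  simp

lemma monoMat_inj {c d : Fin n → Fin n} {a b : Fin n → RatFunc ℚ}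
    (ha : ∀ r, a r ≠ 0) (h : monoMat c a = monoMat d b) : c = d ∧ a = b := by
  have key : ∀ r, c r = d r ∧ a r = b r := by
    intro r
    have h1 := congrFun (congrFun h r) (c r)
    by_cases hcd : c r = d r
    · simp only [monoMat, if_true, hcd] at h1
      exact ⟨hcd, h1⟩
    · simp only [monoMat, if_true, hcd, if_false] at h1
      exact absurd h1 (ha r)
  exact ⟨funext fun r => (key r).1, funext fun r => (key r).2⟩

lemma genCoeff_mul_swap {i j : Fin n} (hij : i ≠ j) (k : ℤ) (r : Fin n) :
    genCoeff i j k r * genCoeff i j k (swap i j r) = 1 := by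
  have hx : xx ^ k ≠ 0 := zpow_ne_zero _ xx_ne_zero
  by_cases hi : r = i
  · subst hi
    simp [genCoeff, hij, hij.symm, hx]
  · by_cases hj : r = j
    · subst hj
      simp [genCoeff, hij, hij.symm, hx]
    · simp [genCoeff, hi, hj, swap_apply_of_ne_of_ne hi hj]

lemma gen_mul_self {i j : Fin n} (hij : i ≠ j) (k : ℤ) :
    monoMat (swap i j) (genCoeff i j k) * monoMat (swap i j) (genCoeff i j k) = 1 := by
  rw [monoMat_mul, ← monoMat_id_one]
  congr 1
  · ext r
    simp
  · ext1 r
    exact genCoeff_mul_swap hij k r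

lemma IsGinfData.gen_mul {c : Fin n → Fin n} {a : Fin n → RatFunc ℚ} (h : IsGinfData c a)
    (i j : Fin n) (k : ℤ) :
    IsGinfData (c ∘ swap i j) (fun r => genCoeff i j k r * a (swap i j r)) := by
  refine ⟨h.1.comp (swap i j).injective, fun r => ?_, ?_⟩
  · obtain ⟨m, hm⟩ := h.2.1 (swap i j r)
    have hb : ∃ m : ℤ, genCoeff i j k r = xx ^ m := by
      unfold genCoeff
      split_ifs
      · exact ⟨-k + k, (zpow_add₀ xx_ne_zero _ _).symm⟩
      · exact ⟨-k, by simp⟩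
      · exact ⟨k, by simp⟩
      · exact ⟨0, by simp⟩
    obtain ⟨m', hm'⟩ := hb
    exact ⟨m' + m, by simp only [zpow_add₀ xx_ne_zero, hm, hm']⟩
  · have hx : xx ^ k ≠ 0 := zpow_ne_zero _ xx_ne_zero
    rw [prod_mul_distrib, Equiv.prod_comp (swap i j) a, h.2.2]
    simp only [genCoeff, prod_mul_distrib, prod_ite_eq', mem_univ, if_true, mul_one]
    rw [zpow_neg, inv_mul_cancel₀ hx]

lemma swap_lt_swap {i j l r : Fin n} (hij : i.val + 1 = j.val) (hlr : l < r)
    (hne : ¬(l = i ∧ r = j)) :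
    swap i j l < swap i j r ∧ ¬(swap i j l = i ∧ swap i j r = j) := by
  simp only [swap_apply_def, Fin.ext_iff, Fin.lt_def] at *
  split_ifs <;> omega

lemma weight_swap {c c' : Fin n → Fin n} {a a' : Fin n → RatFunc ℚ} {i j : Fin n}
    (hij : i.val + 1 = j.val) (hc : c' = c ∘ swap i j)
    (ha : ∀ l r, l < r → ¬(l = i ∧ r = j) → a' r = a (swap i j r)) :
    weight c' a' + pairWeight c a i j = weight c a + pairWeight c' a' i j := by
  have hmem : (i, j) ∈ ({p | p.1 < p.2} : Finset (Fin n × Fin n)) := by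
    simp only [mem_filter, mem_univ, true_and, Fin.lt_def]
    omega
  unfold weight
  rw [← add_sum_erase _ _ hmem, ← add_sum_erase _ (fun p => pairWeight c a p.1 p.2) hmem]
  have hmaps : ∀ p ∈ ({p | p.1 < p.2} : Finset (Fin n × Fin n)).erase (i, j),
      (swap i j p.1, swap i j p.2) ∈
        ({p | p.1 < p.2} : Finset (Fin n × Fin n)).erase (i, j) := by
    rintro ⟨l, r⟩ hp
    simp only [mem_erase, mem_filter, mem_univ, true_and, ne_eq, Prod.mk.injEq] at hp ⊢
    exact (swap_lt_swap hij hp.2 hp.1).symm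
  have hsum : ∑ p ∈ ({p | p.1 < p.2} : Finset (Fin n × Fin n)).erase (i, j),
        pairWeight c' a' p.1 p.2 =
      ∑ p ∈ ({p | p.1 < p.2} : Finset (Fin n × Fin n)).erase (i, j),
        pairWeight c a p.1 p.2 := by
    refine sum_nbij' (fun p => (swap i j p.1, swap i j p.2))
      (fun p => (swap i j p.1, swap i j p.2)) hmaps hmaps (by simp) (by simp) ?_
    rintro ⟨l, r⟩ hp
    simp only [mem_erase, mem_filter, mem_univ, true_and, ne_eq, Prod.mk.injEq] at hp
    simp only [pairWeight, hc, Function.comp]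
    rw [ha l r hp.2 hp.1]
  rw [hsum]
  ring

lemma weight_gen_mul (c : Fin n → Fin n) (a : Fin n → RatFunc ℚ) {i j : Fin n}
    (hij : i.val + 1 = j.val) {k : ℤ} (hk : i.val ≠ 0 → k = 0) :
    weight (c ∘ swap i j) (fun r => genCoeff i j k r * a (swap i j r)) + pairWeight c a i j =
      weight c a + pairWeight (c ∘ swap i j)
        (fun r => genCoeff i j k r * a (swap i j r)) i j := by
  refine weight_swap hij rfl fun l r hlr hne => ?_
  by_cases hi : i.val = 0
  · have h1 : r ≠ i := by
      rintro rfl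
      rw [Fin.lt_def] at hlr
      omega
    have h2 : r ≠ j := by
      rintro rfl
      refine hne ⟨?_, rfl⟩
      rw [Fin.lt_def] at hlr
      ext
      omega
    simp [genCoeff, h1, h2]
  · simp [genCoeff, hk hi]

lemma pairWeight_congr (c : Fin n → Fin n) {a a' : Fin n → RatFunc ℚ} (l r : Fin n)
    (h : a r = a' r) : pairWeight c a l r = pairWeight c a' l r := by
  simp only [pairWeight]
  rw [h]

lemma pairWeight_gen_mul (c : Fin n → Fin n) (a : Fin n → RatFunc ℚ) {i j : Fin n}
    (hij : i ≠ j) (k : ℤ) :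
    pairWeight (c ∘ swap i j) (fun r => genCoeff i j k r * a (swap i j r)) i j =
      pairWeight (c ∘ swap i j) (fun _ => xx ^ k * a i) i j := by
  have h : genCoeff i j k j * a (swap i j j) = xx ^ k * a i := by
    simp [genCoeff, hij.symm]
  exact pairWeight_congr _ i j h

lemma weight_gen_mul_le {c : Fin n → Fin n} (hc : Function.Injective c) (a : Fin n → RatFunc ℚ)
    {i j : Fin n} (hij : i.val + 1 = j.val) {k : ℤ} (hk : i.val ≠ 0 → k = 0) :
    weight (c ∘ swap i j) (fun r => genCoeff i j k r * a (swap i j r)) ≤ weight c a + 1 := by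
  have hne : i ≠ j := by
    rintro rfl
    omega
  have h := weight_gen_mul c a hij hk
  have hcne : c i ≠ c j := hc.ne hne
  have h1 : pairWeight (c ∘ swap i j) (fun r => genCoeff i j k r * a (swap i j r)) i j ≤
      pairWeight c a i j + 1 := by
    rw [pairWeight_gen_mul c a hne]
    rcases lt_or_gt_of_ne hcne with hlt | hlt
    · simp [pairWeight, hlt]
    · simp only [pairWeight, hlt, Function.comp, swap_apply_left, swap_apply_right, hlt.not_gt,
        if_true, if_false]
      split_ifs <;> omega
  omega

lemma tMat_eq (i j : Fin n) (hi : i.val = 0) (hj : j.val = 1) (k : ℤ) :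
    tMat n k = monoMat (swap i j) (genCoeff i j k) := by
  ext r s
  simp only [tMat, monoMat, genCoeff, swap_apply_def, Fin.ext_iff, hi, hj]
  by_cases h0 : r.val = 0
  · by_cases h1 : s.val = 1
    · simp [h0, h1, hj]
    · simp [h0, h1, hj]
  · by_cases h1 : r.val = 1
    · simp [h1, hi]
    · have : 2 ≤ r.val := by omega
      simp [h0, h1, this, eq_comm]

lemma sMat_eq (i j : Fin n) (hij : i.val + 1 = j.val) :
    sMat n (i.val + 2) = monoMat (swap i j) (genCoeff i j 0) := by
  ext r s
  simp only [sMat, monoMat, genCoeff, swap_apply_def, neg_zero, zpow_zero, ite_self, mul_one]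
  refine if_congr ?_ rfl rfl
  simp only [Fin.ext_iff]
  split_ifs <;> omega

lemma mem_Xset_iff (hn : 2 ≤ n) (g : Matrix (Fin n) (Fin n) (RatFunc ℚ)) :
    g ∈ Xset n ↔ ∃ (i j : Fin n) (k : ℤ), i.val + 1 = j.val ∧ (i.val ≠ 0 → k = 0) ∧
      g = monoMat (swap i j) (genCoeff i j k) := by
  constructor
  · rintro (⟨k, rfl⟩ | ⟨m, h3, hm, rfl⟩)
    · exact ⟨⟨0, by omega⟩, ⟨1, by omega⟩, k, rfl, by simp, tMat_eq _ _ rfl rfl k⟩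
    · have h := sMat_eq (n := n) ⟨m - 2, by omega⟩ ⟨m - 1, by omega⟩ (by simp only; omega)
      refine ⟨⟨m - 2, by omega⟩, ⟨m - 1, by omega⟩, 0, by simp only; omega, fun _ => rfl, ?_⟩
      rw [← h]
      simp only
      congr 1
      omega
  · rintro ⟨i, j, k, hij, hk, rfl⟩
    by_cases hi : i.val = 0
    · exact Or.inl ⟨k, (tMat_eq i j hi (by omega) k).symm⟩
    · obtain rfl := hk hi
      exact Or.inr ⟨i.val + 2, by omega, by omega, (sMat_eq i j hij).symm⟩

lemma weight_id_one : weight (n := n) id 1 = 0 := by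
  unfold weight
  refine sum_eq_zero fun p hp => ?_
  simp only [mem_filter, mem_univ, true_and] at hp
  simp [pairWeight, hp.not_gt]

lemma exists_data_prod (hn : 2 ≤ n) (L : List (Matrix (Fin n) (Fin n) (RatFunc ℚ)))
    (hL : ∀ g ∈ L, g ∈ Xset n) :
    ∃ c a, IsGinfData c a ∧ L.prod = monoMat c a ∧ weight c a ≤ L.length := by
  induction L with
  | nil =>
    refine ⟨id, 1, ⟨Function.injective_id, fun _ => ⟨0, by simp⟩, by simp⟩, ?_, ?_⟩
    · simp [monoMat_id_one]
    · simp [weight_id_one]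
  | cons g L ih =>
    obtain ⟨c, a, hca, hp, hw⟩ := ih fun g hg => hL g (List.mem_cons_of_mem _ hg)
    obtain ⟨i, j, k, hij, hk, rfl⟩ := (mem_Xset_iff hn g).1 (hL g List.mem_cons_self)
    refine ⟨_, _, hca.gen_mul i j k, ?_, ?_⟩
    · rw [List.prod_cons, hp, monoMat_mul]
    · have := weight_gen_mul_le hca.1 a hij hk
      rw [List.length_cons]
      omega

/-- An element on which no generator descends is the identity. -/
lemma eq_id_one_of_forall_le (hn : 2 ≤ n) {c : Fin n → Fin n} {a : Fin n → RatFunc ℚ}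
    (h : IsGinfData c a)
    (hmin : ∀ (i j : Fin n) (k : ℤ), i.val + 1 = j.val → (i.val ≠ 0 → k = 0) →
      weight c a ≤ weight (c ∘ swap i j) (fun r => genCoeff i j k r * a (swap i j r))) :
    c = id ∧ a = 1 := by
  have hpair : ∀ (i j : Fin n) (k : ℤ), i.val + 1 = j.val → (i.val ≠ 0 → k = 0) →
      xx ^ k * a i = 1 → c i < c j ∧ a j = 1 := by
    intro i j k hij hk hki
    have hne : i ≠ j := by
      rintro rfl
      omega
    have h1 := weight_gen_mul c a hij hk
    have h2 := hmin i j k hij hk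
    rw [pairWeight_gen_mul c a hne] at h1
    have hle : pairWeight c a i j ≤
        pairWeight (c ∘ swap i j) (fun _ => xx ^ k * a i) i j := by omega
    rcases lt_or_gt_of_ne (h.1.ne hne) with hlt | hlt
    · refine ⟨hlt, ?_⟩
      by_contra ha
      simp [pairWeight, hlt, hlt.not_gt, ha] at hle
    · simp [pairWeight, hlt, hlt.not_gt, hki] at hle
  have hstep : ∀ (m : ℕ) (hm : m + 1 < n),
      c ⟨m, by omega⟩ < c ⟨m + 1, hm⟩ ∧ a ⟨m + 1, hm⟩ = 1 := by
    intro m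
    induction m with
    | zero =>
      intro hm
      obtain ⟨k, hk⟩ := h.2.1 ⟨0, by omega⟩
      refine hpair _ _ (-k) rfl (by simp) ?_
      rw [hk, ← zpow_add₀ xx_ne_zero]
      simp
    | succ m ih =>
      intro hm
      refine hpair _ _ 0 rfl (fun _ => rfl) ?_
      simp [(ih (by omega)).2]
  have hmono : StrictMono c := by
    obtain ⟨N, rfl⟩ : ∃ N, n = N + 1 := ⟨n - 1, by omega⟩
    exact Fin.strictMono_iff_lt_succ.2 fun i => (hstep i.val (by omega)).1
  have ha : ∀ r : Fin n, r ≠ ⟨0, by omega⟩ → a r = 1 := by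
    rintro ⟨_ | m, hr⟩ h0
    · exact absurd rfl h0
    · exact (hstep m hr).2
  refine ⟨?_, funext fun r => ?_⟩
  · have hr : Set.range c = Set.range (id : Fin n → Fin n) := by
      rw [(Finite.surjective_of_injective h.1).range_eq, Set.range_id]
    exact (StrictMono.range_inj hmono strictMono_id).1 hr
  · by_cases hr : r = ⟨0, by omega⟩
    · have hp := h.2.2
      rw [prod_eq_single (⟨0, by omega⟩ : Fin n) (fun r _ hr => ha r hr) (by simp)] at hp
      rw [hr, hp, Pi.one_apply]
    · exact ha r hr

lemma exists_list_prod (hn : 2 ≤ n) (m : ℕ) (c : Fin n → Fin n) (a : Fin n → RatFunc ℚ)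
    (h : IsGinfData c a) (hm : weight c a = m) :
    ∃ L : List (Matrix (Fin n) (Fin n) (RatFunc ℚ)),
      L.length ≤ m ∧ (∀ g ∈ L, g ∈ Xset n) ∧ L.prod = monoMat c a := by
  induction m using Nat.strong_induction_on generalizing c a with
  | _ m ih =>
    by_cases hmin : ∀ (i j : Fin n) (k : ℤ), i.val + 1 = j.val → (i.val ≠ 0 → k = 0) →
        weight c a ≤ weight (c ∘ swap i j) (fun r => genCoeff i j k r * a (swap i j r))
    · obtain ⟨rfl, rfl⟩ := eq_id_one_of_forall_le hn h hmin
      exact ⟨[], by simp, by simp, by simp [monoMat_id_one]⟩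
    · push Not at hmin
      obtain ⟨i, j, k, hij, hk, hlt⟩ := hmin
      obtain ⟨L, hlen, hmem, hprod⟩ := ih _ (hm ▸ hlt) _ _ (h.gen_mul i j k) rfl
      have hne : i ≠ j := by
        rintro rfl
        omega
      refine ⟨monoMat (swap i j) (genCoeff i j k) :: L, ?_, ?_, ?_⟩
      · rw [List.length_cons]
        omega
      · intro g hg
        rcases List.mem_cons.1 hg with rfl | hg
        · exact (mem_Xset_iff hn _).2 ⟨i, j, k, hij, hk, rfl⟩
        · exact hmem g hg
      · rw [List.prod_cons, hprod, ← monoMat_mul, ← mul_assoc, gen_mul_self hne, one_mul]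

lemma len_monoMat (hn : 2 ≤ n) {c : Fin n → Fin n} {a : Fin n → RatFunc ℚ}
    (h : IsGinfData c a) : len n (monoMat c a) = weight c a := by
  have hlb : ∀ L : List (Matrix (Fin n) (Fin n) (RatFunc ℚ)), (∀ g ∈ L, g ∈ Xset n) →
      L.prod = monoMat c a → weight c a ≤ L.length := by
    intro L hmem hprod
    obtain ⟨c', a', -, hprod', hle⟩ := exists_data_prod hn L hmem
    obtain ⟨rfl, rfl⟩ := monoMat_inj h.ne_zero (hprod.symm.trans hprod')
    exact hle
  obtain ⟨L, hlen, hmem, hprod⟩ := exists_list_prod hn (weight c a) c a h rfl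
  have hle : len n (monoMat c a) ≤ L.length := Nat.sInf_le ⟨L, rfl, hmem, hprod⟩
  refine le_antisymm (hle.trans hlen) ?_
  refine le_csInf ⟨_, L, rfl, hmem, hprod⟩ ?_
  rintro _ ⟨L', rfl, hmem', hprod'⟩
  exact hlb L' hmem' hprod'

lemma IsGinf.eq_monoMat {w : Matrix (Fin n) (Fin n) (RatFunc ℚ)} (hw : IsGinf n w)
    {c : Fin n → Fin n} (hc : ∀ r, w r (c r) ≠ 0) :
    w = monoMat c (fun r => w r (c r)) := by
  ext r s
  by_cases hs : s = c r
  · simp [monoMat, hs]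
  · simp only [monoMat, hs, if_false]
    by_contra h0
    exact hs ((hw.1 r).unique h0 (hc r))

lemma IsGinf.isGinfData {w : Matrix (Fin n) (Fin n) (RatFunc ℚ)} (hw : IsGinf n w)
    {c : Fin n → Fin n} (hc : ∀ r, w r (c r) ≠ 0) :
    IsGinfData c (fun r => w r (c r)) := by
  refine ⟨fun r s hrs => ?_, fun r => hw.2.2.1 r _ (hc r), ?_⟩
  · exact (hw.2.1 (c r)).unique (hc r) (hrs ▸ hc s)
  · rw [← hw.2.2.2]
    refine prod_congr rfl fun r _ => (sum_eq_single (c r) (fun s _ hs => ?_) (by simp)).symm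
    by_contra h0
    exact hs ((hw.1 r).unique h0 (hc r))

end


/-- rows `1` and `2`, 1-indexed, are `Fin` indices `0` and `1`. -/
theorem stmt_2 (n : ℕ) (hn : 2 ≤ n) (w : Matrix (Fin n) (Fin n) (RatFunc ℚ))
    (hw : IsGinf n w) (c : Fin n → Fin n) (hc : ∀ r : Fin n, w r (c r) ≠ 0) :
    (((c ⟨0, by omega⟩ : ℕ) < (c ⟨1, by omega⟩ : ℕ)) →
      ∀ k : ℤ, ((len n (tMat n k * w) : ℤ) = (len n w : ℤ) - 1 ↔
        w ⟨1, by omega⟩ (c ⟨1, by omega⟩) ≠ 1)) ∧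
    (((c ⟨1, by omega⟩ : ℕ) < (c ⟨0, by omega⟩ : ℕ)) →
      ∀ k : ℤ, ((len n (tMat n k * w) : ℤ) = (len n w : ℤ) - 1 ↔
        w ⟨0, by omega⟩ (c ⟨0, by omega⟩) = xx ^ (-k))) := by
  have hdata := hw.isGinfData hc
  have hwm := hw.eq_monoMat hc
  set a : Fin n → RatFunc ℚ := fun r => w r (c r) with ha
  have ha0 : w ⟨0, by omega⟩ (c ⟨0, by omega⟩) = a ⟨0, by omega⟩ := rfl
  have ha1 : w ⟨1, by omega⟩ (c ⟨1, by omega⟩) = a ⟨1, by omega⟩ := rfl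
  rw [ha0, ha1]
  clear_value a
  subst hwm
  generalize hi : (⟨0, by omega⟩ : Fin n) = i
  generalize hj : (⟨1, by omega⟩ : Fin n) = j
  have hij : i.val + 1 = j.val := by simp [← hi, ← hj]
  have hne : i ≠ j := by
    rintro rfl
    omega
  have hi0 : i.val = 0 := by simp [← hi]
  have hlen : ∀ k : ℤ, len n (tMat n k * monoMat c a) + pairWeight c a i j =
      len n (monoMat c a) + pairWeight (c ∘ swap i j) (fun _ => xx ^ k * a i) i j := by
    intro k
    rw [tMat_eq i j hi0 (by omega) k, monoMat_mul, len_monoMat hn hdata,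
      len_monoMat hn (hdata.gen_mul i j k), ← pairWeight_gen_mul c a hne,
      weight_gen_mul c a hij (fun h => absurd hi0 h)]
  constructor
  · intro hlt k
    have hlt' : c i < c j := hlt
    have h := hlen k
    by_cases h1 : a j = 1
    · simp [pairWeight, hlt', hlt'.not_gt, h1] at h
      simp only [h1, ne_eq, not_true, iff_false]
      omega
    · simp [pairWeight, hlt', hlt'.not_gt, h1] at h
      simp only [h1, ne_eq, not_false_eq_true, iff_true]
      omega
  · intro hlt k
    have hlt' : c j < c i := hlt
    have h := hlen k
    have hiff : xx ^ k * a i = 1 ↔ a i = xx ^ (-k) := by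
      rw [zpow_neg, mul_comm]
      exact mul_eq_one_iff_eq_inv₀ (zpow_ne_zero _ xx_ne_zero)
    rw [← hiff]
    by_cases h1 : xx ^ k * a i = 1
    · simp [pairWeight, hlt', hlt'.not_gt, h1] at h
      simp only [h1, iff_true]
      omega
    · simp [pairWeight, hlt', hlt'.not_gt, h1] at h
      simp only [h1, iff_false]
      omega
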